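/- Let M be a nonsingular n×n odd-block {0,1}-matrix with associated map φ: {0,…,n} → {0,…,n} (where M_{ij} is odd iff min{φ(j-1),φ(j)} < i ≤ max{φ(j-1),φ(j)}). Then φ is a bijection (permutation) of {0,1,…,n}. -/

import Mathlib

/-- The forward differences of a function on `Fin (n + 1)` telescope. -/
theorem Fin.sum_univ_succ_sub_castSucc {A : Type*} [AddCommGroup A] {n : ℕ}
    (f : Fin (n + 1) → A) :
    ∑ j : Fin n, (f j.succ - f j.castSucc) = f (Fin.last n) - f 0 := by
  rw [Finset.sum_sub_distrib, sub_eq_sub_iff_add_eq_add, add_comm, ← Fin.sum_univ_succ,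
    Fin.sum_univ_castSucc, add_comm]

/-- If column `j` of `M`, multiplied by a suitable scalar `s j ≠ 0`, is the difference of two
consecutive terms of a sequence of vectors, and the sequence repeats a value, then `M` is
singular. -/
theorem Matrix.det_eq_zero_of_mul_eq_sub {R : Type*} [CommRing R] [IsDomain R] {n : ℕ}
    {M : Matrix (Fin n) (Fin n) R} {s : Fin n → R} (hs : ∀ j, s j ≠ 0)
    {T : Fin (n + 1) → Fin n → R}
    (hM : ∀ i j, M i j * s j = T j.succ i - T j.castSucc i)
    {a b : Fin (n + 1)} (hab : a < b) (hT : T a = T b) : M.det = 0 := by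
  refine Matrix.exists_mulVec_eq_zero_iff.mp
    ⟨fun j => if a ≤ j.castSucc ∧ j.succ ≤ b then s j else 0, fun h => ?_, ?_⟩
  · have hn : (a : ℕ) < n := by omega
    have := congrFun h ⟨a, hn⟩
    rw [if_pos ⟨le_rfl, hab⟩] at this
    exact hs _ this
  · ext i
    have hsum := Fin.sum_univ_succ_sub_castSucc (fun k => T (max a (min k b)) i)
    simp only [min_eq_right (Fin.le_last b), max_eq_right hab.le, min_eq_left (Fin.zero_le b),
      max_eq_left (Fin.zero_le a), hT, sub_self] at hsum
    refine Eq.trans ?_ hsum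
    simp only [Matrix.mulVec, dotProduct]
    refine Finset.sum_congr rfl fun j _ => ?_
    split_ifs with h
    · rw [hM, min_eq_left h.2, min_eq_left (j.castSucc_lt_succ.le.trans h.2), max_eq_right h.1,
        max_eq_right (h.1.trans j.castSucc_lt_succ.le)]
    · have : max a (min j.succ b) = max a (min j.castSucc b) := by
        simp only [Fin.le_def, Fin.val_castSucc, Fin.val_succ] at h
        simp only [Fin.ext_iff, Fin.coe_max, Fin.coe_min, Fin.val_castSucc, Fin.val_succ]
        omega
      rw [this, sub_self, mul_zero]


/-- Let `M` be a nonsingular `n×n` odd-block `{0,1}`-matrix with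
associated map `φ : {0,…,n} → {0,…,n}` (entry `M i j` is odd iff
`min{φ(j-1),φ(j)} < i ≤ max{φ(j-1),φ(j)}`, in 1-based indexing). Then `φ` is a
bijection of `{0,1,…,n}`.  Here row `i` and column `j` of `M` (1-based `1,…,n`) are
represented by `i j : Fin n`, with 1-based index `i+1`; the endpoints `j-1, j` of
column `j` correspond to `j.castSucc, j.succ : Fin (n+1)`. -/
theorem odd_block_phi_is_permutation
    (n : ℕ) (M : Matrix (Fin n) (Fin n) ℤ)
    (h01 : ∀ i j, M i j = 0 ∨ M i j = 1)
    -- in each column the nonzero entries form one consecutive block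
    (hblock : ∀ j i₁ i₂ i₃ : Fin n, i₁ ≤ i₂ → i₂ ≤ i₃ →
      M i₁ j ≠ 0 → M i₃ j ≠ 0 → M i₂ j ≠ 0)
    (φ : Fin (n + 1) → Fin (n + 1))
    -- the odd-block condition: M_{ij} is odd iff min{φ(j-1),φ(j)} < i ≤ max{φ(j-1),φ(j)}
    (hodd : ∀ i j : Fin n, Odd (M i j) ↔
      (min ((φ j.castSucc : Fin (n+1)) : ℕ) ((φ j.succ : Fin (n+1)) : ℕ) < (i : ℕ) + 1 ∧
       (i : ℕ) + 1 ≤ max ((φ j.castSucc : Fin (n+1)) : ℕ) ((φ j.succ : Fin (n+1)) : ℕ)))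
    (hdet : M.det ≠ 0) :
    Function.Bijective φ := by
  rw [← Finite.injective_iff_bijective]
  refine Function.Injective.of_lt_imp_ne fun a b hab hφ => hdet ?_
  refine Matrix.det_eq_zero_of_mul_eq_sub
    (s := fun j => if φ j.castSucc ≤ φ j.succ then 1 else -1)
    (T := fun k i => if (i : ℕ) + 1 ≤ φ k then 1 else 0)
    (fun j => by split_ifs <;> decide) (fun i j => ?_) hab (by simp only [hφ])
  have h := hodd i j
  simp only [Fin.le_def]
  rcases h01 i j with h0 | h0 <;> rw [h0] at h ⊢
  · have := mt h.mpr (by decide)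
    split_ifs <;> omega
  · have := h.mp (by decide)
    split_ifs <;> omega
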